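/- (Error bound for Holevo–Schumacher–Westmoreland coding.) Let p : Fin L → ℝ be a probability mass function and σ_x, x ∈ Fin L, be d×d complex density matrices, with average state σ̄ = ∑_x p(x) σ_x. Let λ_min be the smallest nonzero eigenvalue of σ̄, let μ_min be the minimum over all x with p(x) > 0 of the smallest nonzero eigenvalue of σ_x, and let χ = S(σ̄) − ∑_x p(x) S(σ_x) be the Holevo quantity of the ensemble. Then for every n ∈ ℕ, every M ∈ ℕ with 1 ≤ M ≤ L^n, and every δ > 0, there exist codewords x(1)^n, …, x(M)^n ∈ (Fin L)^n and positive semidefinite matrices Λ_1, …, Λ_M indexed by (Fin n → Fin d) with ∑_{s=1}^M Λ_s ≤ 𝟙 such that (1/M) ∑_{s=1}^M Tr(Λ_s σ_{x(s)^n}) ≥ 1 − 4·exp(−2nδ²/(log₂ λ_min)²) − 2·exp(−2nδ²/(log₂ μ_min)²) − 4M·2^{−n(χ − 2δ)}. -/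

import Mathlib

open Finset Real
open scoped ComplexOrder

/-- The von Neumann entropy (base 2) of a Hermitian matrix, computed from its
eigenvalues (with the convention `0 · log₂ 0 = 0`, automatic since `logb 2 0 = 0`). -/
noncomputable def vonNeumannEntropy {d : ℕ} {ρ : Matrix (Fin d) (Fin d) ℂ}
    (hρ : ρ.IsHermitian) : ℝ :=
  -∑ i, hρ.eigenvalues i * Real.logb 2 (hρ.eigenvalues i)

/-- The `n`-fold tensor product `σ_{x^n}` of the states `σ_{x_i}`: the complex matrix
indexed by `Fin n → Fin d` with entries `∏_{i<n} (σ_{x_i})(y_i, z_i)`. -/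
noncomputable def tensorPowState {L d n : ℕ} (σ : Fin L → Matrix (Fin d) (Fin d) ℂ)
    (xs : Fin n → Fin L) : Matrix (Fin n → Fin d) (Fin n → Fin d) ℂ :=
  Matrix.of fun ys zs => ∏ i, σ (xs i) (ys i) (zs i)


section LA
open Matrix

theorem trace_mul_nonneg_re {ι : Type*} [Fintype ι] [DecidableEq ι] {A B : Matrix ι ι ℂ}
    (hA : A.PosSemidef) (hB : B.PosSemidef) : 0 ≤ (A * B).trace.re := by
  obtain ⟨C, rfl⟩ : ∃ C : Matrix ι ι ℂ, A = Cᴴ * C := by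
    open scoped MatrixOrder in
    exact (CStarAlgebra.nonneg_iff_eq_star_mul_self.mp hA.nonneg)
  rw [Matrix.mul_assoc, Matrix.trace_mul_comm]
  exact (Complex.nonneg_iff.mp (hB.mul_mul_conjTranspose_same C).trace_nonneg).1

open scoped MatrixOrder Matrix.Norms.L2Operator in
theorem exists_sqrt {ι : Type*} [Fintype ι] [DecidableEq ι] {W : Matrix ι ι ℂ}
    (hW : W.PosDef) :
    ∃ X : Matrix ι ι ℂ, X.PosDef ∧ X * X = W ∧ ∀ S : Matrix ι ι ℂ, S.PosSemidef →
      (W - S * S).PosSemidef → (X - S).PosSemidef := by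
  have hW0 : (0:Matrix ι ι ℂ) ≤ W := hW.posSemidef.nonneg
  have hX : CFC.sqrt W * CFC.sqrt W = W := CFC.sqrt_mul_sqrt_self W hW0
  refine ⟨CFC.sqrt W, ?_, hX, ?_⟩
  · have h0 : (CFC.sqrt W).PosSemidef := Matrix.nonneg_iff_posSemidef.mp (CFC.sqrt_nonneg W)
    rw [h0.posDef_iff_isUnit]
    have := hW.isUnit
    rw [← hX] at this
    exact isUnit_of_mul_isUnit_left this
  · intro S hS hS2
    have : S = CFC.sqrt (S * S) := (CFC.sqrt_mul_self S hS.nonneg).symm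
    rw [← Matrix.le_iff, this]
    exact CFC.sqrt_le_sqrt _ _ (Matrix.le_iff.mpr hS2)

theorem hayashi_nagaoka {ι : Type*} [Fintype ι] [DecidableEq ι] {S T X : Matrix ι ι ℂ}
    (hS : S.PosSemidef) (hT : T.PosSemidef) (hX : X.PosDef) (hXX : X * X = S + T)
    (hXS : (X - S).PosSemidef) :
    ((2:ℂ) • (1 - S) + (4:ℂ) • T - (1 - X⁻¹ * S * X⁻¹)).PosSemidef := by
  have hU : IsUnit X.det := (Matrix.isUnit_iff_isUnit_det X).mp hX.isUnit
  have h1 : X⁻¹ * X = 1 := Matrix.nonsing_inv_mul X hU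
  have h2 : X * X⁻¹ = 1 := Matrix.mul_nonsing_inv X hU
  have hRh : (X⁻¹)ᴴ = X⁻¹ := hX.isHermitian.inv
  set R := X⁻¹ with hR
  have hB : (1 - R)ᴴ = 1 - R := by simp [hRh]
  have hC : (1 + (1 - R))ᴴ = 1 + (1 - R) := by simp [hRh]
  have a1 := hT.mul_mul_conjTranspose_same (1 + (1 - R))
  have a2 := (hS.mul_mul_conjTranspose_same (1 - R)).smul (show (0:ℂ) ≤ 2 by norm_num)
  have a3 := hXS.smul (show (0:ℂ) ≤ 4 by norm_num)
  rw [hB] at a2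
  rw [hC] at a1
  have key := (a1.add a2).add a3
  convert key using 1
  have hTe : T = X * X - S := by rw [hXX]; abel
  have e2 : R * (X * X) = X := by rw [← Matrix.mul_assoc, h1, Matrix.one_mul]
  have e3 : X * X * R = X := by rw [Matrix.mul_assoc, h2, Matrix.mul_one]
  rw [hTe]
  simp only [mul_add, add_mul, mul_sub, sub_mul, e2, e3, h2, one_mul, mul_one]
  module

theorem posSemidef_sq_of_isHermitian {ι : Type*} [Fintype ι] [DecidableEq ι] {A : Matrix ι ι ℂ}
    (hA : A.IsHermitian) : (A * A).PosSemidef := by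
  have := posSemidef_self_mul_conjTranspose A
  rwa [hA.eq] at this

theorem posSemidef_PQP {ι : Type*} [Fintype ι] [DecidableEq ι] {P Q : Matrix ι ι ℂ}
    (hP : P.IsHermitian) (hQ : Q.PosSemidef) : (P * Q * P).PosSemidef := by
  have := hQ.mul_mul_conjTranspose_same P
  rwa [hP.eq] at this

theorem posSemidef_proj {ι : Type*} [Fintype ι] [DecidableEq ι] {P : Matrix ι ι ℂ}
    (hP : P.IsHermitian) (hPP : P * P = P) : P.PosSemidef := by
  have := posSemidef_sq_of_isHermitian hP
  rwa [hPP] at this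

theorem posSemidef_one_sub_proj {ι : Type*} [Fintype ι] [DecidableEq ι] {P : Matrix ι ι ℂ}
    (hP : P.IsHermitian) (hPP : P * P = P) : (1 - P).PosSemidef := by
  apply posSemidef_proj
  · simp [Matrix.IsHermitian, hP.eq]
  · rw [mul_sub, sub_mul, sub_mul, hPP]; simp

theorem trace_gentle {ι : Type*} [Fintype ι] [DecidableEq ι] {ρ P Q : Matrix ι ι ℂ}
    (hρ : ρ.PosSemidef) (hP : P.IsHermitian) (hPP : P * P = P) (hQ : Q.IsHermitian)
    (hQQ : Q * Q = Q) (hc : ρ * Q = Q * ρ) (htr : ρ.trace = 1) :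
    (ρ * (1 - P * Q * P)).trace.re ≤ 2 * (ρ * (1 - P)).trace.re + (ρ * (1 - Q)).trace.re := by
  have hQ' : (1 - Q).IsHermitian := by simp [Matrix.IsHermitian, hQ.eq]
  have b1 : (P * Q * P).PosSemidef := posSemidef_PQP hP (posSemidef_proj hQ hQQ)
  have b2 : (1 - P).PosSemidef := posSemidef_one_sub_proj hP hPP
  have hρ2 : ((1 - Q) * ρ * (1 - Q)).PosSemidef := posSemidef_PQP hQ' hρ
  have k1 := trace_mul_nonneg_re hρ2 b1
  have k2 := trace_mul_nonneg_re hρ2 b2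
  have hQPQ : (Q - Q * P * Q).IsHermitian := by
    simp [Matrix.IsHermitian, hP.eq, hQ.eq, Matrix.mul_assoc]
  have k3 : 0 ≤ (ρ * ((Q - Q * P * Q) * (Q - Q * P * Q))).trace.re :=
    trace_mul_nonneg_re hρ (posSemidef_sq_of_isHermitian hQPQ)
  have c0 : (1 - Q) * ρ * (1 - Q) = ρ - Q * ρ * Q := by
    have e : Q * ρ * Q = Q * ρ := by rw [Matrix.mul_assoc, hc, ← Matrix.mul_assoc, hQQ]
    rw [mul_sub, sub_mul, sub_mul, sub_mul, e, one_mul, hc]; simp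
  have c (Y : Matrix ι ι ℂ) : ((1 - Q) * ρ * (1 - Q) * Y).trace =
      (ρ * Y).trace - (ρ * (Q * Y * Q)).trace := by
    have e : (Q * ρ * Q * Y).trace = (ρ * (Q * Y * Q)).trace := by
      rw [Matrix.mul_assoc, Matrix.mul_assoc, Matrix.trace_mul_comm]
      simp only [Matrix.mul_assoc]
    rw [c0, sub_mul, trace_sub, e]
  have k3' : (ρ * ((Q - Q * P * Q) * (Q - Q * P * Q))) =
      ρ * Q - (2:ℂ) • (ρ * (Q * P * Q)) + ρ * (Q * (P * Q * P) * Q) := by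
    have e1 : Q * (Q * P * Q) = Q * P * Q := by
      rw [← Matrix.mul_assoc, ← Matrix.mul_assoc, hQQ]
    have e2 : Q * P * Q * Q = Q * P * Q := by rw [Matrix.mul_assoc, hQQ]
    have e3 : Q * P * Q * (Q * P * Q) = Q * (P * Q * P) * Q := by
      rw [← Matrix.mul_assoc, ← Matrix.mul_assoc, e2]
      simp only [Matrix.mul_assoc]
    rw [mul_sub (Q - Q * P * Q), sub_mul, sub_mul, hQQ, e1, e2, e3, mul_sub, mul_sub, mul_sub]
    module
  rw [c] at k1 k2
  rw [k3'] at k3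
  have k4 : Q * (1 - P) * Q = Q - Q * P * Q := by
    rw [mul_sub, sub_mul, mul_one, hQQ]
  rw [k4] at k2
  simp only [mul_sub, trace_sub, trace_add, trace_smul, Complex.sub_re, Complex.add_re, mul_one,
    htr, Complex.one_re, smul_eq_mul, Complex.mul_re, Complex.re_ofNat, Complex.im_ofNat] at k1 k2 k3 ⊢
  linarith

theorem decoder {ι κ : Type*} [Fintype ι] [DecidableEq ι] [Fintype κ] [DecidableEq κ]
    (S : κ → Matrix ι ι ℂ) (hS : ∀ s, (S s).PosSemidef) (hS2 : ∀ s, (S s - S s * S s).PosSemidef)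
    (k : ℝ) (hk : 0 < k) :
    ∃ Λ : κ → Matrix ι ι ℂ, (∀ s, (Λ s).PosSemidef) ∧ (1 - ∑ s, Λ s).PosSemidef ∧
      ∀ s, ∀ ρ : Matrix ι ι ℂ, ρ.PosSemidef → ρ.trace = 1 →
        1 - (Λ s * ρ).trace.re ≤ 2 * (ρ * (1 - S s)).trace.re +
          4 * (∑ t ∈ univ.erase s, (ρ * S t).trace.re) + 4 * k := by
  have hk1 : ((k:ℂ) • (1 : Matrix ι ι ℂ)).PosDef :=
    Matrix.PosDef.one.smul (by exact_mod_cast hk)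
  have hsum : (∑ s, S s).PosSemidef := Matrix.posSemidef_sum _ (fun s _ => hS s)
  obtain ⟨X, hX, hXX, hXS⟩ := exists_sqrt (hk1.posSemidef_add hsum)
  have hU : IsUnit X.det := (Matrix.isUnit_iff_isUnit_det X).mp hX.isUnit
  have h1 : X⁻¹ * X = 1 := Matrix.nonsing_inv_mul X hU
  have h2 : X * X⁻¹ = 1 := Matrix.mul_nonsing_inv X hU
  have hRh : (X⁻¹).IsHermitian := hX.isHermitian.inv
  refine ⟨fun s => X⁻¹ * S s * X⁻¹, fun s => posSemidef_PQP hRh (hS s), ?_, ?_⟩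
  · have e : 1 - ∑ s, X⁻¹ * S s * X⁻¹ = X⁻¹ * ((k:ℂ) • (1 : Matrix ι ι ℂ)) * X⁻¹ := by
      rw [← Finset.sum_mul, ← Finset.mul_sum]
      have : ∑ s, S s = X * X - (k:ℂ) • (1 : Matrix ι ι ℂ) := by rw [hXX]; abel
      rw [this, mul_sub, sub_mul, ← Matrix.mul_assoc, h1, one_mul, h2]; abel
    rw [e]
    exact posSemidef_PQP hRh hk1.posSemidef
  · intro s ρ hρ htr
    have hT : (∑ t ∈ univ.erase s, S t).PosSemidef := Matrix.posSemidef_sum _ (fun s _ => hS s)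
    have hT' := hT.add hk1.posSemidef
    have hsplit : (∑ s, S s) = S s + ∑ t ∈ univ.erase s, S t :=
      (Finset.add_sum_erase _ _ (Finset.mem_univ s)).symm
    have hWS : X * X = S s + (∑ t ∈ univ.erase s, S t + (k:ℂ) • (1 : Matrix ι ι ℂ)) := by
      rw [hXX, hsplit, add_assoc]
    have hXSs := hXS (S s) (hS s) (by
      have := (hS2 s).add hT'
      rw [hsplit]
      convert this using 1
      abel)
    have hn := hayashi_nagaoka (hS s) hT' hX hWS hXSs
    have := trace_mul_nonneg_re hρ hn
    rw [Matrix.trace_mul_comm (X⁻¹ * S s * X⁻¹)]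
    simp only [mul_sub, mul_add, Matrix.mul_smul, Matrix.mul_sum, trace_sub, trace_add, trace_smul, 
      trace_sum, Complex.sub_re, Complex.add_re, mul_one, Complex.re_sum, Complex.im_sum,
      htr, Complex.one_re, smul_eq_mul, Complex.mul_re, Complex.re_ofNat, Complex.im_ofNat,
      Complex.ofReal_re, Complex.ofReal_im] at this ⊢
    simp only [zero_mul, sub_zero] at this ⊢
    linarith

end LA

section Avg

theorem avg_prod {κ α : Type*} [Fintype κ] [DecidableEq κ] [Fintype α] {R : Type*} [CommSemiring R]
    (h : κ → α → R) : ∑ c : κ → α, ∏ s, h s (c s) = ∏ s, ∑ a, h s a := by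
  classical
  rw [Finset.prod_univ_sum, Fintype.piFinset_univ]

theorem avg_two {κ α : Type*} [Fintype κ] [DecidableEq κ] [Fintype α] (q : α → ℝ)
    (hq : ∑ a, q a = 1) (s t : κ) (hst : s ≠ t) (g : α → α → ℝ) :
    ∑ c : κ → α, (∏ u, q (c u)) * g (c s) (c t) = ∑ a, ∑ b, q a * q b * g a b := by
  classical
  have key (a b : α) : ∑ c : κ → α, (∏ u, q (c u)) * ((if c s = a then 1 else 0) *
      (if c t = b then 1 else 0)) = q a * q b := by
    have e (c : κ → α) : (∏ u, q (c u)) * ((if c s = a then 1 else 0) *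
      (if c t = b then 1 else 0)) = ∏ u, (q (c u) * ((if u = s then (if c u = a then 1 else 0) else 1) *
        (if u = t then (if c u = b then 1 else 0) else 1))) := by
      rw [Finset.prod_mul_distrib, Finset.prod_mul_distrib, Finset.prod_ite_eq', Finset.prod_ite_eq']
      simp
    simp_rw [e]
    rw [avg_prod (fun u x => (q x * ((if u = s then (if x = a then 1 else 0) else 1) *
        (if u = t then (if x = b then 1 else 0) else 1))))]
    rw [← Finset.mul_prod_erase _ _ (Finset.mem_univ s), 
      ← Finset.mul_prod_erase _ _ (Finset.mem_erase.mpr ⟨hst.symm, Finset.mem_univ t⟩),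
      Finset.prod_eq_one]
    · simp [hst, hst.symm]
    · intro u hu
      simp only [Finset.mem_erase] at hu
      simp [hu.1, hu.2.1, hq]
  have e (c : κ → α) : g (c s) (c t) = ∑ a, ∑ b, g a b * ((if c s = a then 1 else 0) *
      (if c t = b then 1 else 0)) := by
    simp
  simp_rw [e, Finset.mul_sum]
  rw [Finset.sum_comm]
  refine Finset.sum_congr rfl fun a _ => ?_
  rw [Finset.sum_comm]
  refine Finset.sum_congr rfl fun b _ => ?_
  rw [← key a b, Finset.sum_mul]
  refine Finset.sum_congr rfl fun c _ => ?_
  ring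

theorem avg_one {κ α : Type*} [Fintype κ] [DecidableEq κ] [Fintype α] (q : α → ℝ)
    (hq : ∑ a, q a = 1) (s : κ) (f : α → ℝ) :
    ∑ c : κ → α, (∏ u, q (c u)) * f (c s) = ∑ a, q a * f a := by
  classical
  have e (c : κ → α) : (∏ u, q (c u)) * f (c s) =
      ∏ u, (q (c u) * (if u = s then f (c u) else 1)) := by
    rw [Finset.prod_mul_distrib, Finset.prod_ite_eq']
    simp
  simp_rw [e]
  rw [avg_prod (fun u x => (q x * (if u = s then f x else 1))),
    ← Finset.mul_prod_erase _ _ (Finset.mem_univ s), Finset.prod_eq_one]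
  · simp
  · intro u hu
    simp only [Finset.mem_erase] at hu
    simp [hu.1, hq]

end Avg

section Packing
open Matrix

theorem packing {ι α : Type*} [Fintype ι] [DecidableEq ι] [Fintype α] (q : α → ℝ)
    (hq0 : ∀ a, 0 ≤ q a) (hq : ∑ a, q a = 1) (ρ : α → Matrix ι ι ℂ) (P : Matrix ι ι ℂ)
    (Q : α → Matrix ι ι ℂ) (hρ : ∀ a, (ρ a).PosSemidef) (htr : ∀ a, (ρ a).trace = 1)
    (hP : P.IsHermitian) (hPP : P * P = P) (hQ : ∀ a, (Q a).IsHermitian)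
    (hQQ : ∀ a, Q a * Q a = Q a) (hc : ∀ a, ρ a * Q a = Q a * ρ a) (ε₁ ε₂ k : ℝ) (hk : 0 < k)
    (h1 : ∑ a, q a * (ρ a * (1 - P)).trace.re ≤ ε₁)
    (h2 : ∑ a, q a * (ρ a * (1 - Q a)).trace.re ≤ ε₂)
    (h3 : ∀ b, ∑ a, q a * (ρ a * (P * Q b * P)).trace.re ≤ k) (M : ℕ) (hM : 1 ≤ M) :
    ∃ (codes : Fin M → α) (Λ : Fin M → Matrix ι ι ℂ), (∀ s, (Λ s).PosSemidef) ∧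
      (1 - ∑ s, Λ s).PosSemidef ∧
      1 - 4 * ε₁ - 2 * ε₂ - 4 * M * k ≤
        (1 / (M : ℝ)) * ∑ s, (Matrix.trace (Λ s * ρ (codes s))).re := by
  classical
  have hS (a) : (P * Q a * P).PosSemidef := posSemidef_PQP hP (posSemidef_proj (hQ a) (hQQ a))
  have hS2 (a) : (P * Q a * P - (P * Q a * P) * (P * Q a * P)).PosSemidef := by
    have := ((posSemidef_one_sub_proj hP hPP).mul_mul_conjTranspose_same (P * Q a))
    rw [conjTranspose_mul, hP.eq, (hQ a).eq] at this
    have e : P * Q a * P - (P * Q a * P) * (P * Q a * P) = P * Q a * (1 - P) * (Q a * P) := by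
      rw [mul_sub, sub_mul, mul_one]
      congr 1
      · rw [← Matrix.mul_assoc, Matrix.mul_assoc P (Q a) (Q a), hQQ]
      · simp only [Matrix.mul_assoc]
        rw [← Matrix.mul_assoc P P, hPP]
    rw [e]; exact this
  have hdec (c : Fin M → α) := decoder (fun s => P * Q (c s) * P) (fun s => hS _) (fun s => hS2 _) k hk
  choose Λ hΛ0 hΛ1 hΛ using hdec
  let w : (Fin M → α) → ℝ := fun c => ∏ s, q (c s)
  have hw0 (c) : 0 ≤ w c := Finset.prod_nonneg fun s _ => hq0 _
  have hw1 : ∑ c, w c = 1 := by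
    rw [avg_prod (fun (_ : Fin M) a => q a)]; simp [hq]
  have hMpos : (0:ℝ) < M := by exact_mod_cast hM
  let F : α → ℝ := fun a => 2 * (2 * (ρ a * (1 - P)).trace.re + (ρ a * (1 - Q a)).trace.re)
  have hF : ∑ a, q a * F a ≤ 4 * ε₁ + 2 * ε₂ := by
    have : ∑ a, q a * F a = 4 * (∑ a, q a * (ρ a * (1 - P)).trace.re) +
        2 * ∑ a, q a * (ρ a * (1 - Q a)).trace.re := by
      rw [Finset.mul_sum, Finset.mul_sum, ← Finset.sum_add_distrib]
      refine Finset.sum_congr rfl fun a _ => ?_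
      simp only [F]; ring
    rw [this]; linarith
  let G : α → α → ℝ := fun a b => (ρ a * (P * Q b * P)).trace.re
  have hG : ∑ a, ∑ b, q a * q b * G a b ≤ k := by
    rw [Finset.sum_comm]
    calc ∑ b, ∑ a, q a * q b * G a b = ∑ b, q b * ∑ a, q a * G a b := by
          refine Finset.sum_congr rfl fun b _ => ?_
          rw [Finset.mul_sum]
          refine Finset.sum_congr rfl fun a _ => ?_
          ring
      _ ≤ ∑ b, q b * k := Finset.sum_le_sum fun b _ => mul_le_mul_of_nonneg_left (h3 b) (hq0 b)
      _ = k := by rw [← Finset.sum_mul, hq, one_mul]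
  -- pointwise error bound
  have hpt (c : Fin M → α) (s : Fin M) : 1 - (Λ c s * ρ (c s)).trace.re ≤
      F (c s) + 4 * (∑ t ∈ univ.erase s, G (c s) (c t)) + 4 * k := by
    have a1 := hΛ c s (ρ (c s)) (hρ _) (htr _)
    have a2 := trace_gentle (hρ (c s)) hP hPP (hQ (c s)) (hQQ _) (hc _) (htr _)
    simp only [F, G]
    linarith
  -- averaged error bound
  have havg : ∑ c, w c * ∑ s, (1 - (Λ c s * ρ (c s)).trace.re) ≤
      M * (4 * ε₁ + 2 * ε₂ + 4 * M * k) := by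
    have hs (s : Fin M) : ∑ c, w c * (1 - (Λ c s * ρ (c s)).trace.re) ≤
        4 * ε₁ + 2 * ε₂ + 4 * M * k := by
      calc ∑ c, w c * (1 - (Λ c s * ρ (c s)).trace.re)
          ≤ ∑ c, w c * (F (c s) + 4 * (∑ t ∈ univ.erase s, G (c s) (c t)) + 4 * k) :=
            Finset.sum_le_sum fun c _ => mul_le_mul_of_nonneg_left (hpt c s) (hw0 c)
        _ = ∑ c, w c * F (c s) + 4 * ∑ t ∈ univ.erase s, ∑ c, w c * G (c s) (c t) +
              4 * k * ∑ c, w c := by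
            rw [Finset.sum_comm, Finset.mul_sum, Finset.mul_sum, ← Finset.sum_add_distrib,
              ← Finset.sum_add_distrib]
            refine Finset.sum_congr rfl fun c _ => ?_
            rw [← Finset.mul_sum]; ring
        _ ≤ (4 * ε₁ + 2 * ε₂) + 4 * ∑ t ∈ univ.erase s, k + 4 * k := by
            rw [hw1, avg_one q hq s F]
            have : ∑ t ∈ univ.erase s, ∑ c, w c * G (c s) (c t) ≤ ∑ t ∈ univ.erase s, k := by
              refine Finset.sum_le_sum fun t ht => ?_
              rw [avg_two q hq s t (Finset.ne_of_mem_erase ht).symm G]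
              exact hG
            linarith
        _ = 4 * ε₁ + 2 * ε₂ + 4 * M * k := by
            rw [Finset.sum_const, Finset.card_erase_of_mem (Finset.mem_univ s)]
            simp only [Finset.card_univ, Fintype.card_fin, nsmul_eq_mul, Nat.cast_sub hM]
            push_cast; ring
    simp_rw [Finset.mul_sum]
    rw [Finset.sum_comm]
    calc _ ≤ ∑ s : Fin M, (4 * ε₁ + 2 * ε₂ + 4 * M * k) := Finset.sum_le_sum fun s _ => hs s
      _ = _ := by simp; ring
  obtain ⟨c, hcc⟩ : ∃ c, ∑ s, (1 - (Λ c s * ρ (c s)).trace.re) ≤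
      M * (4 * ε₁ + 2 * ε₂ + 4 * M * k) := by
    by_contra! hcon
    have : ∑ c, w c * (M * (4 * ε₁ + 2 * ε₂ + 4 * M * k)) <
        ∑ c, w c * ∑ s, (1 - (Λ c s * ρ (c s)).trace.re) := by
      apply Finset.sum_lt_sum
      · exact fun c _ => mul_le_mul_of_nonneg_left (hcon c).le (hw0 c)
      · obtain ⟨c, -, hcw⟩ : ∃ c ∈ univ, w c ≠ 0 := by
          apply Finset.exists_ne_zero_of_sum_ne_zero
          rw [hw1]; norm_num
        exact ⟨c, Finset.mem_univ _, mul_lt_mul_of_pos_left (hcon c)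
          (lt_of_le_of_ne (hw0 c) hcw.symm)⟩
    rw [← Finset.sum_mul, hw1, one_mul] at this
    linarith
  refine ⟨c, Λ c, hΛ0 c, hΛ1 c, ?_⟩
  rw [Finset.sum_sub_distrib] at hcc
  simp only [Finset.sum_const, Finset.card_univ, Fintype.card_fin, nsmul_eq_mul, mul_one] at hcc
  rw [one_div, inv_mul_eq_div, le_div_iff₀ hMpos]
  linarith

end Packing
section Hoeffding
open MeasureTheory ProbabilityTheory

theorem mgf_fin {β : Type*} [Fintype β] (w f : β → ℝ) (hw0 : ∀ y, 0 ≤ w y) (hw1 : ∑ y, w y = 1)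
    (a b : ℝ) (hf : ∀ y, w y ≠ 0 → f y ∈ Set.Icc a b) (t : ℝ) :
    ∑ y, w y * Real.exp (t * (f y - ∑ z, w z * f z)) ≤ Real.exp ((b - a) ^ 2 / 4 * t ^ 2 / 2) := by
  let _ : MeasurableSpace β := ⊤
  have : DiscreteMeasurableSpace β := ⟨fun _ => trivial⟩
  let pm : PMF β := PMF.ofFintype (fun y => ENNReal.ofReal (w y)) (by
    rw [← ENNReal.ofReal_sum_of_nonneg (fun y _ => hw0 y), hw1, ENNReal.ofReal_one])
  have hpm (y) : (pm y).toReal = w y := by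
    simp [pm, ENNReal.toReal_ofReal (hw0 y)]
  have hae : ∀ᵐ y ∂pm.toMeasure, f y ∈ Set.Icc a b := by
    rw [ae_iff, PMF.toMeasure_apply_eq_zero_iff _ (MeasurableSet.of_discrete), Set.disjoint_left]
    intro y hy hy2
    apply hy2
    apply hf
    intro h0
    apply hy
    simp [pm, h0]
  have h := (hasSubgaussianMGF_of_mem_Icc (μ := pm.toMeasure) (X := f)
    (measurable_of_finite f).aemeasurable hae).mgf_le t
  rw [mgf, PMF.integral_eq_sum, PMF.integral_eq_sum] at h
  simp only [hpm, smul_eq_mul] at h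
  convert h using 2
  push_cast
  rw [Real.norm_eq_abs, div_pow, sq_abs]
  ring

theorem hoeffding_fin {β : Type*} [Fintype β] (w f : β → ℝ) (hw0 : ∀ y, 0 ≤ w y)
    (hw1 : ∑ y, w y = 1) (a b : ℝ) (hab : b - a ≠ 0) (hf : ∀ y, w y ≠ 0 → f y ∈ Set.Icc a b)
    (n : ℕ) (δ : ℝ) (hδ : 0 < δ) (s : Finset (Fin n → β))
    (hs : ∀ z ∈ s, ∏ i, w (z i) ≠ 0 → n * (∑ y, w y * f y + δ) ≤ ∑ i, f (z i)) :
    ∑ z ∈ s, ∏ i, w (z i) ≤ Real.exp (-(2 * n * δ ^ 2) / (b - a) ^ 2) := by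
  classical
  have hmgf := mgf_fin w f hw0 hw1 a b hf (4 * δ / (b - a) ^ 2)
  generalize hm : ∑ y, w y * f y = m at hs hmgf
  have hfinal : -(4 * δ / (b - a) ^ 2 * (n * δ)) + n * ((b - a) ^ 2 / 4 * (4 * δ / (b - a) ^ 2) ^ 2 / 2)
      = -(2 * n * δ ^ 2) / (b - a) ^ 2 := by
    field_simp
    ring
  have ht0' : 0 ≤ 4 * δ / (b - a) ^ 2 := by positivity
  generalize ht : 4 * δ / (b - a) ^ 2 = t at hfinal hmgf ht0'
  have ht0 : 0 ≤ t := ht0'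
  have hW (z : Fin n → β) : 0 ≤ ∏ i, w (z i) := Finset.prod_nonneg fun i _ => hw0 _
  calc ∑ z ∈ s, ∏ i, w (z i)
      ≤ ∑ z ∈ s, (∏ i, w (z i)) * Real.exp (t * (∑ i, (f (z i) - m)) - t * (n * δ)) := by
        refine Finset.sum_le_sum fun z hz => ?_
        by_cases h0 : ∏ i, w (z i) = 0
        · rw [h0]; simp
        · refine le_mul_of_one_le_right (hW z) ?_
          rw [Real.one_le_exp_iff, ← mul_sub]
          apply mul_nonneg ht0
          have := hs z hz h0
          rw [Finset.sum_sub_distrib]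
          simp
          linarith
    _ ≤ ∑ z : Fin n → β, (∏ i, w (z i)) * Real.exp (t * (∑ i, (f (z i) - m)) - t * (n * δ)) :=
        Finset.sum_le_sum_of_subset_of_nonneg (Finset.subset_univ _)
          fun z _ _ => mul_nonneg (hW z) (Real.exp_nonneg _)
    _ = Real.exp (- (t * (n * δ))) * ∑ z : Fin n → β, ∏ i, (w (z i) * Real.exp (t * (f (z i) - m))) := by
        rw [Finset.mul_sum]
        refine Finset.sum_congr rfl fun z _ => ?_
        rw [Finset.prod_mul_distrib, ← Real.exp_sum, ← Finset.mul_sum, sub_eq_add_neg, Real.exp_add]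
        ring
    _ = Real.exp (- (t * (n * δ))) * (∑ y, w y * Real.exp (t * (f y - m))) ^ n := by
        rw [avg_prod (fun (_ : Fin n) y => w y * Real.exp (t * (f y - m)))]
        simp
    _ ≤ Real.exp (- (t * (n * δ))) * (Real.exp ((b - a) ^ 2 / 4 * t ^ 2 / 2)) ^ n := by
        gcongr
        · exact Finset.sum_nonneg fun y _ => mul_nonneg (hw0 y) (Real.exp_nonneg _)
    _ = Real.exp (-(2 * n * δ ^ 2) / (b - a) ^ 2) := by
        rw [← Real.exp_nat_mul, ← Real.exp_add]
        rw [hfinal]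

end Hoeffding

section Tensor
open Matrix

noncomputable def tpMat {n : ℕ} {d : Type*} (A : Fin n → Matrix d d ℂ) :
    Matrix (Fin n → d) (Fin n → d) ℂ :=
  Matrix.of fun ys zs => ∏ i, A i (ys i) (zs i)

variable {n : ℕ} {d : Type*} [Fintype d] [DecidableEq d]

theorem tpMat_mul (A B : Fin n → Matrix d d ℂ) :
    tpMat (fun i => A i * B i) = tpMat A * tpMat B := by
  ext y z
  simp only [tpMat, Matrix.of_apply, Matrix.mul_apply]
  rw [← avg_prod (fun i j => A i (y i) j * B i j (z i))]
  simp only [Finset.prod_mul_distrib]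

theorem tpMat_conjTranspose (A : Fin n → Matrix d d ℂ) :
    tpMat (fun i => (A i)ᴴ) = (tpMat A)ᴴ := by
  ext y z
  simp [tpMat, Matrix.conjTranspose_apply]

theorem tpMat_diagonal (g : Fin n → d → ℂ) :
    tpMat (fun i => Matrix.diagonal (g i)) = Matrix.diagonal (fun y => ∏ i, g i (y i)) := by
  ext y z
  simp only [tpMat, Matrix.of_apply, Matrix.diagonal_apply]
  by_cases h : y = z
  · subst h; simp
  · rw [if_neg h]
    obtain ⟨i, hi⟩ := Function.ne_iff.mp h
    exact Finset.prod_eq_zero (Finset.mem_univ i) (by simp [hi])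

theorem tpMat_one : tpMat (fun _ : Fin n => (1 : Matrix d d ℂ)) = 1 := by
  have := tpMat_diagonal (n := n) (d := d) (fun _ _ => 1)
  simpa using this

theorem tpMat_avg {L : ℕ} (p : Fin L → ℝ) (σ : Fin L → Matrix d d ℂ) :
    tpMat (fun _ : Fin n => ∑ x, p x • σ x) =
      ∑ xs : Fin n → Fin L, (∏ i, p (xs i)) • tpMat (fun i => σ (xs i)) := by
  ext y z
  simp only [tpMat, Matrix.of_apply, Matrix.sum_apply, Matrix.smul_apply]
  rw [← avg_prod (fun i x => p x • σ x (y i) (z i))]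
  refine Finset.sum_congr rfl fun xs _ => ?_
  simp only [Complex.real_smul, Finset.prod_mul_distrib]
  push_cast
  rfl

end Tensor

section Diag
open Matrix

variable {ι : Type*} [Fintype ι] [DecidableEq ι]

noncomputable def dg (V : Matrix ι ι ℂ) (g : ι → ℝ) : Matrix ι ι ℂ :=
  V * Matrix.diagonal (fun i => (g i : ℂ)) * Vᴴ

theorem dg_mul {V : Matrix ι ι ℂ} (hV : Vᴴ * V = 1) (g h : ι → ℝ) :
    dg V g * dg V h = dg V (fun i => g i * h i) := by
  have : dg V g * dg V h = V * (Matrix.diagonal (fun i => (g i : ℂ)) * (Vᴴ * V) *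
      Matrix.diagonal (fun i => (h i : ℂ))) * Vᴴ := by
    simp only [dg, Matrix.mul_assoc]
  rw [this, hV, mul_one, Matrix.diagonal_mul_diagonal, dg]
  simp

theorem dg_herm (V : Matrix ι ι ℂ) (g : ι → ℝ) : (dg V g).IsHermitian := by
  unfold dg Matrix.IsHermitian
  rw [conjTranspose_mul, conjTranspose_mul, conjTranspose_conjTranspose, diagonal_conjTranspose,
    ← Matrix.mul_assoc]
  congr 3
  ext i
  simp

theorem dg_sub (V : Matrix ι ι ℂ) (g h : ι → ℝ) :
    dg V g - dg V h = dg V (fun i => g i - h i) := by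
  unfold dg
  rw [← sub_mul, ← mul_sub, diagonal_sub]
  simp

theorem dg_const {V : Matrix ι ι ℂ} (hV : V * Vᴴ = 1) (k : ℝ) : dg V (fun _ => k) = (k : ℂ) • 1 := by
  unfold dg
  rw [← smul_one_eq_diagonal]
  simp [hV]

theorem dg_one {V : Matrix ι ι ℂ} (hV : V * Vᴴ = 1) : dg V (fun _ => 1) = 1 := by
  rw [dg_const hV]; simp

theorem dg_trace {V : Matrix ι ι ℂ} (hV : Vᴴ * V = 1) (g : ι → ℝ) :
    (dg V g).trace = ((∑ i, g i : ℝ) : ℂ) := by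
  unfold dg
  rw [Matrix.trace_mul_comm, ← Matrix.mul_assoc, hV, one_mul, trace_diagonal]
  push_cast; rfl

theorem dg_posSemidef (V : Matrix ι ι ℂ) (g : ι → ℝ) (hg : ∀ i, 0 ≤ g i) : (dg V g).PosSemidef := by
  apply PosSemidef.mul_mul_conjTranspose_same
  apply PosSemidef.diagonal
  intro i
  simpa using hg i

theorem dg_spectral {A : Matrix ι ι ℂ} (hA : A.IsHermitian) :
    A = dg (hA.eigenvectorUnitary : Matrix ι ι ℂ) hA.eigenvalues := by
  have := hA.spectral_theorem
  rw [Unitary.conjStarAlgAut_apply] at this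
  exact this

end Diag

section Final
open Matrix

theorem logb_sum_prod {n : ℕ} (g : Fin n → ℝ) (hg : ∀ i, 0 < g i) :
    (2:ℝ) ^ (∑ i, Real.logb 2 (g i)) = ∏ i, g i := by
  rw [Real.rpow_sum_of_pos (by norm_num)]
  exact Finset.prod_congr rfl fun i _ => Real.rpow_logb (by norm_num) (by norm_num) (hg i)

theorem hsw_main {d L : ℕ}
    (p : Fin L → ℝ) (hp0 : ∀ x, 0 ≤ p x) (hp1 : ∑ x, p x = 1)
    (σ : Fin L → Matrix (Fin d) (Fin d) ℂ)
    (hσpsd : ∀ x, (σ x).PosSemidef) (hσtr : ∀ x, Matrix.trace (σ x) = 1)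
    (hbar : (∑ x, p x • σ x).PosSemidef)
    (lamMin : ℝ) (hlam1 : Real.logb 2 lamMin ≠ 0)
    (hlam : IsLeast {μ : ℝ | μ ≠ 0 ∧ ∃ i, hbar.isHermitian.eigenvalues i = μ} lamMin)
    (muMin : ℝ) (hmu1 : Real.logb 2 muMin ≠ 0)
    (hmu : IsLeast {μ : ℝ | μ ≠ 0 ∧
      ∃ x, 0 < p x ∧ ∃ i, (hσpsd x).isHermitian.eigenvalues i = μ} muMin)
    (n : ℕ) (M : ℕ) (hM1 : 1 ≤ M) (δ : ℝ) (hδ : 0 < δ) :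
    ∃ (codes : Fin M → (Fin n → Fin L))
      (Λ : Fin M → Matrix (Fin n → Fin d) (Fin n → Fin d) ℂ),
      (∀ s, (Λ s).PosSemidef) ∧ (1 - ∑ s, Λ s).PosSemidef ∧
      1 - 4 * Real.exp (-(2 * n * δ ^ 2) / (Real.logb 2 lamMin) ^ 2)
        - 2 * Real.exp (-(2 * n * δ ^ 2) / (Real.logb 2 muMin) ^ 2)
        - 4 * M * (2 : ℝ) ^ (-(n : ℝ) *
            ((vonNeumannEntropy hbar.isHermitian -
              ∑ x, p x * vonNeumannEntropy (hσpsd x).isHermitian) - 2 * δ)) ≤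
      (1 / (M : ℝ)) * ∑ s, (Matrix.trace (Λ s * tensorPowState σ (codes s))).re := by
  classical
  -- spectral data of the average state
  obtain ⟨lam, hlamdef⟩ : ∃ lam, lam = hbar.isHermitian.eigenvalues := ⟨_, rfl⟩
  obtain ⟨V, hVdef⟩ : ∃ V : Matrix (Fin d) (Fin d) ℂ, V = hbar.isHermitian.eigenvectorUnitary :=
    ⟨_, rfl⟩
  have hbarspec : ∑ x, p x • σ x = dg V lam := by
    rw [hVdef, hlamdef]; exact dg_spectral _
  have hV1 : Vᴴ * V = 1 := by
    rw [hVdef]; exact Unitary.coe_star_mul_self _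
  have hV2 : V * Vᴴ = 1 := mul_eq_one_comm.mp hV1
  have hlam0 (i) : 0 ≤ lam i := by rw [hlamdef]; exact hbar.eigenvalues_nonneg i
  have hbartr : (∑ x, p x • σ x).trace = 1 := by
    rw [trace_sum]
    simp only [trace_smul, hσtr]
    rw [← Finset.sum_smul, hp1, one_smul]
  have hlamsum : ∑ i, lam i = 1 := by
    rw [hbarspec, dg_trace hV1] at hbartr
    exact_mod_cast hbartr
  -- spectral data of the signal states
  obtain ⟨r, hrdef⟩ : ∃ r : Fin L → Fin d → ℝ, r = fun x => (hσpsd x).isHermitian.eigenvalues :=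
    ⟨_, rfl⟩
  obtain ⟨U, hUdef⟩ : ∃ U : Fin L → Matrix (Fin d) (Fin d) ℂ,
    U = fun x => ((hσpsd x).isHermitian.eigenvectorUnitary : Matrix (Fin d) (Fin d) ℂ) := ⟨_, rfl⟩
  have hspec (x) : σ x = dg (U x) (r x) := by
    rw [hUdef, hrdef]; exact dg_spectral _
  have hU1 (x) : (U x)ᴴ * U x = 1 := by
    rw [hUdef]; exact Unitary.coe_star_mul_self _
  have hr0 (x i) : 0 ≤ r x i := by rw [hrdef]; exact (hσpsd x).eigenvalues_nonneg i
  have hrsum (x) : ∑ i, r x i = 1 := by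
    have := hσtr x
    rw [hspec, dg_trace (hU1 x)] at this
    exact_mod_cast this
  obtain ⟨S, hS⟩ : ∃ S, S = vonNeumannEntropy hbar.isHermitian := ⟨_, rfl⟩
  obtain ⟨H, hH⟩ : ∃ H, H = ∑ x, p x * vonNeumannEntropy (hσpsd x).isHermitian := ⟨_, rfl⟩
  have hS' : S = -∑ i, lam i * Real.logb 2 (lam i) := by rw [hS, hlamdef]; rfl
  have hH' : H = ∑ x, p x * -∑ i, r x i * Real.logb 2 (r x i) := by rw [hH, hrdef]; rfl
  rw [← hS, ← hH]
  -- tensor powers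
  have htp_unit (W : Fin n → Matrix (Fin d) (Fin d) ℂ) (hW : ∀ i, (W i)ᴴ * W i = 1) :
      (tpMat W)ᴴ * tpMat W = 1 := by
    rw [← tpMat_conjTranspose, ← tpMat_mul]
    simp only [hW]
    exact tpMat_one
  have htp_dg (W : Fin n → Matrix (Fin d) (Fin d) ℂ) (g : Fin n → Fin d → ℝ) :
      tpMat (fun i => dg (W i) (g i)) = dg (tpMat W) (fun y => ∏ i, g i (y i)) := by
    unfold dg
    rw [tpMat_mul, tpMat_mul, tpMat_conjTranspose, tpMat_diagonal]
    push_cast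
    rfl
  obtain ⟨VV, hVV⟩ : ∃ VV, VV = tpMat (fun _ : Fin n => V) := ⟨_, rfl⟩
  have hVV1 : VVᴴ * VV = 1 := by rw [hVV]; exact htp_unit _ fun _ => hV1
  have hVV2 : VV * VVᴴ = 1 := mul_eq_one_comm.mp hVV1
  let UU : (Fin n → Fin L) → Matrix (Fin n → Fin d) (Fin n → Fin d) ℂ :=
    fun xs => tpMat (fun i => U (xs i))
  have hUU1 (xs) : (UU xs)ᴴ * UU xs = 1 := htp_unit _ fun _ => hU1 _
  have hUU2 (xs) : UU xs * (UU xs)ᴴ = 1 := mul_eq_one_comm.mp (hUU1 xs)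
  let q : (Fin n → Fin L) → ℝ := fun xs => ∏ i, p (xs i)
  have hq0 (xs) : 0 ≤ q xs := Finset.prod_nonneg fun i _ => hp0 _
  have hq1 : ∑ xs, q xs = 1 := by
    rw [avg_prod (fun (_ : Fin n) a => p a)]; simp [hp1]
  let ll : (Fin n → Fin d) → ℝ := fun y => ∏ i, lam (y i)
  let rr : (Fin n → Fin L) → (Fin n → Fin d) → ℝ := fun xs y => ∏ i, r (xs i) (y i)
  have hll0 (y) : 0 ≤ ll y := Finset.prod_nonneg fun i _ => hlam0 _
  have hrr0 (xs y) : 0 ≤ rr xs y := Finset.prod_nonneg fun i _ => hr0 _ _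
  have hrrsum (xs) : ∑ y, rr xs y = 1 := by
    rw [avg_prod (fun (i : Fin n) a => r (xs i) a)]; simp [hrsum]
  have hρ (xs : Fin n → Fin L) : tensorPowState σ xs = dg (UU xs) (rr xs) := by
    have : tensorPowState σ xs = tpMat (fun i => σ (xs i)) := rfl
    rw [this]
    simp only [hspec]
    rw [htp_dg]
  have hρbar : ∑ xs, q xs • tensorPowState σ xs = dg VV ll := by
    have := tpMat_avg (n := n) p σ
    rw [hbarspec, htp_dg] at this
    rw [hVV]
    exact this.symm
  -- typical sets
  let B : (Fin n → Fin d) → ℝ := fun y => if ll y ≤ (2:ℝ) ^ (-(n:ℝ) * (S - δ)) then 1 else 0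
  let A : (Fin n → Fin L) → (Fin n → Fin d) → ℝ :=
    fun xs y => if (2:ℝ) ^ (-(n:ℝ) * (H + δ)) ≤ rr xs y then 1 else 0
  let P := dg VV B
  let Q := fun xs => dg (UU xs) (A xs)
  have hBB : (fun y => B y * B y) = B := by
    funext y; simp only [B]; split_ifs <;> simp
  have hAA (xs) : (fun y => A xs y * A xs y) = A xs := by
    funext y; simp only [A]; split_ifs <;> simp
  have hk1 : (0:ℝ) < (2:ℝ) ^ (-(n:ℝ) * (S - δ)) := by positivity
  have hk2 : (0:ℝ) < (2:ℝ) ^ (-(n:ℝ) * (H + δ)) := by positivity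
  have hk : (2:ℝ) ^ (-(n:ℝ) * ((S - H) - 2 * δ)) =
      (2:ℝ) ^ (-(n:ℝ) * (S - δ)) * ((2:ℝ) ^ (-(n:ℝ) * (H + δ)))⁻¹ := by
    rw [← Real.rpow_neg (by norm_num), ← Real.rpow_add (by norm_num)]
    congr 1; ring
  -- linearity of the trace against the average state
  have hlin (Y : Matrix (Fin n → Fin d) (Fin n → Fin d) ℂ) :
      ∑ xs, q xs * (tensorPowState σ xs * Y).trace.re = (dg VV ll * Y).trace.re := by
    rw [← hρbar, Finset.sum_mul, trace_sum, Complex.re_sum]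
    refine Finset.sum_congr rfl fun xs _ => ?_
    rw [Matrix.smul_mul, trace_smul, Complex.real_smul, Complex.re_ofReal_mul]
  have hlogle (a : ℝ) (h0 : 0 ≤ a) (h1 : a ≤ 1) : Real.logb 2 a ≤ 0 :=
    Real.logb_nonpos (by norm_num) h0 h1
  have hlamle (i) : lam i ≤ 1 := by
    rw [← hlamsum]; exact Finset.single_le_sum (fun j _ => hlam0 j) (Finset.mem_univ i)
  have hrle (x i) : r x i ≤ 1 := by
    rw [← hrsum x]; exact Finset.single_le_sum (fun j _ => hr0 x j) (Finset.mem_univ i)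
  have hlamMinpos : 0 < lamMin := by
    obtain ⟨h0, i, hi⟩ := hlam.1
    rw [← hlamdef] at hi
    exact lt_of_le_of_ne (hi ▸ hlam0 i) h0.symm
  have hmuMinpos : 0 < muMin := by
    obtain ⟨h0, x, -, i, hi⟩ := hmu.1
    have : r x i = muMin := by rw [hrdef]; exact hi
    exact lt_of_le_of_ne (this ▸ hr0 x i) h0.symm
  have hE1 : ∑ xs, q xs * (tensorPowState σ xs * (1 - P)).trace.re ≤
      Real.exp (-(2 * n * δ ^ 2) / (Real.logb 2 lamMin) ^ 2) := by
    rw [hlin, ← dg_one hVV2, dg_sub, dg_mul hVV1, dg_trace hVV1, Complex.ofReal_re]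
    have h := hoeffding_fin lam (fun i => Real.logb 2 (lam i)) hlam0 hlamsum
      (Real.logb 2 lamMin) 0 (by simpa using hlam1) (fun i hi => ⟨?_, hlogle _ (hlam0 i) (hlamle i)⟩)
      n δ hδ (univ.filter fun y => ¬ ll y ≤ (2:ℝ) ^ (-(n:ℝ) * (S - δ))) ?_
    · rw [Finset.sum_filter, zero_sub, neg_sq] at h
      refine le_trans (le_of_eq ?_) h
      refine Finset.sum_congr rfl fun y _ => ?_
      simp only [B]
      split_ifs <;> simp [ll]
    · apply Real.logb_le_logb_of_le (by norm_num) hlamMinpos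
      exact hlam.2 ⟨hi, i, by rw [hlamdef]⟩
    · intro y hy h0
      rw [Finset.mem_filter, not_le] at hy
      have hpos (i) : 0 < lam (y i) := lt_of_le_of_ne (hlam0 _)
        (Finset.prod_ne_zero_iff.mp h0 i (Finset.mem_univ i)).symm
      have h2 := hy.2
      simp only [ll] at h2
      rw [← logb_sum_prod _ hpos, Real.rpow_lt_rpow_left_iff (by norm_num)] at h2
      have hm : ∑ i, lam i * Real.logb 2 (lam i) = -S := by rw [hS']; ring
      rw [hm]
      refine le_trans (le_of_eq ?_) h2.le
      ring
  have hE2 : ∑ xs, q xs * (tensorPowState σ xs * (1 - Q xs)).trace.re ≤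
      Real.exp (-(2 * n * δ ^ 2) / (Real.logb 2 muMin) ^ 2) := by
    have e (xs) : (tensorPowState σ xs * (1 - Q xs)).trace.re = ∑ y, rr xs y * (1 - A xs y) := by
      rw [hρ, ← dg_one (hUU2 xs), dg_sub, dg_mul (hUU1 xs), dg_trace (hUU1 xs), Complex.ofReal_re]
    simp only [e]
    have h := hoeffding_fin (fun z : Fin L × Fin d => p z.1 * r z.1 z.2)
      (fun z => - Real.logb 2 (r z.1 z.2)) (fun z => mul_nonneg (hp0 _) (hr0 _ _))
      (by
        rw [Fintype.sum_prod_type]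
        simp only [← Finset.mul_sum, hrsum, mul_one, hp1])
      0 (- Real.logb 2 muMin) (by simpa using hmu1)
      (fun z hz => ⟨by
        have := hlogle _ (hr0 z.1 z.2) (hrle z.1 z.2)
        simpa using this, ?_⟩)
      n δ hδ (univ.filter fun z => ¬ (2:ℝ) ^ (-(n:ℝ) * (H + δ)) ≤
        rr (fun i => (z i).1) (fun i => (z i).2)) ?_
    · rw [Finset.sum_filter, sub_zero, neg_sq] at h
      refine le_trans (le_of_eq ?_) h
      rw [← Equiv.sum_comp (Equiv.arrowProdEquivProdArrow (Fin n) (fun _ => Fin L) (fun _ => Fin d)).symm,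
        Fintype.sum_prod_type]
      refine Finset.sum_congr rfl fun xs _ => ?_
      rw [Finset.mul_sum]
      refine Finset.sum_congr rfl fun y _ => ?_
      change q xs * (rr xs y * (1 - A xs y)) =
        if ¬ (2:ℝ) ^ (-(n:ℝ) * (H + δ)) ≤ rr xs y then ∏ i, p (xs i) * r (xs i) (y i) else 0
      rw [Finset.prod_mul_distrib]
      by_cases hA : (2:ℝ) ^ (-(n:ℝ) * (H + δ)) ≤ rr xs y
      · have hA1 : A xs y = 1 := if_pos hA
        rw [hA1, if_neg (not_not.mpr hA)]; ring
      · have hA0 : A xs y = 0 := if_neg hA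
        rw [hA0, if_pos hA, sub_zero, mul_one]
    · apply neg_le_neg
      apply Real.logb_le_logb_of_le (by norm_num) hmuMinpos
      have hz1 := left_ne_zero_of_mul hz
      have hz2 := right_ne_zero_of_mul hz
      exact hmu.2 ⟨hz2, z.1, lt_of_le_of_ne (hp0 _) hz1.symm, z.2, by rw [hrdef]⟩
    · intro z hz h0
      rw [Finset.mem_filter, not_le] at hz
      have hpos (i) : 0 < r (z i).1 (z i).2 := lt_of_le_of_ne (hr0 _ _)
        (right_ne_zero_of_mul (Finset.prod_ne_zero_iff.mp h0 i (Finset.mem_univ i))).symm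
      have h2 := hz.2
      simp only [rr] at h2
      rw [← logb_sum_prod _ hpos, Real.rpow_lt_rpow_left_iff (by norm_num)] at h2
      have hm : ∑ z : Fin L × Fin d, p z.1 * r z.1 z.2 * -Real.logb 2 (r z.1 z.2) = H := by
        rw [Fintype.sum_prod_type, hH']
        refine Finset.sum_congr rfl fun x _ => ?_
        rw [← Finset.sum_neg_distrib, Finset.mul_sum]
        refine Finset.sum_congr rfl fun y _ => ?_
        ring
      rw [hm, Finset.sum_neg_distrib]
      linarith
  have hE3 (ys : Fin n → Fin L) : ∑ xs, q xs * (tensorPowState σ xs * (P * Q ys * P)).trace.re ≤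
      (2:ℝ) ^ (-(n:ℝ) * ((S - H) - 2 * δ)) := by
    have hcard : ∑ y, A ys y ≤ ((2:ℝ) ^ (-(n:ℝ) * (H + δ)))⁻¹ := by
      rw [← one_div, le_div_iff₀ hk2, Finset.sum_mul, ← hrrsum ys]
      refine Finset.sum_le_sum fun y _ => ?_
      simp only [A]
      split_ifs with h
      · simpa using h
      · simpa using hrr0 ys y
    rw [hlin, hk]
    have e : (dg VV ll * (P * Q ys * P)).trace = (dg VV (fun y => B y * ll y * B y) * Q ys).trace := by
      have : dg VV (fun y => B y * ll y * B y) = P * dg VV ll * P := by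
        simp only [P]; rw [dg_mul hVV1, dg_mul hVV1]
      rw [this, Matrix.trace_mul_comm]
      simp only [Matrix.mul_assoc]
      rw [Matrix.trace_mul_comm P]
      simp only [Matrix.mul_assoc]
      rw [Matrix.trace_mul_comm (Q ys)]
      simp only [Matrix.mul_assoc]
    rw [e]
    have hQpsd : (Q ys).PosSemidef := dg_posSemidef _ _ fun y => by
      simp only [A]; split_ifs <;> norm_num
    have hD : (dg VV (fun y => (2:ℝ) ^ (-(n:ℝ) * (S - δ)) - B y * ll y * B y)).PosSemidef :=
      dg_posSemidef _ _ fun y => by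
        simp only [B]; split_ifs with h
        · simpa using h
        · simpa using hk1.le
    have := trace_mul_nonneg_re hD hQpsd
    rw [← dg_sub, dg_const hVV2, sub_mul, trace_sub, Matrix.smul_mul, one_mul, trace_smul,
      dg_trace (hUU1 ys), Complex.sub_re, smul_eq_mul, ← Complex.ofReal_mul, Complex.ofReal_re] at this
    have h5 := mul_le_mul_of_nonneg_left hcard hk1.le
    linarith
  exact packing q hq0 hq1 (fun xs => tensorPowState σ xs) P Q
    (fun xs => by rw [hρ]; exact dg_posSemidef _ _ (hrr0 xs))
    (fun xs => by rw [hρ, dg_trace (hUU1 xs), hrrsum]; simp)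
    (dg_herm _ _) (by simp only [P]; rw [dg_mul hVV1, hBB])
    (fun xs => dg_herm _ _) (fun xs => by simp only [Q]; rw [dg_mul (hUU1 xs), hAA])
    (fun xs => by
      simp only [Q]; rw [hρ, dg_mul (hUU1 xs), dg_mul (hUU1 xs)]
      congr 1; funext y; ring)
    _ _ _ (by positivity) hE1 hE2 hE3 M hM1

end Final

/-- Error bound for Holevo–Schumacher–Westmoreland coding: for every `n`, every
`1 ≤ M ≤ L^n` and every `δ > 0`, there exist `M` codewords and a sub-POVM whose average
success probability is at least
`1 - 4 exp(-2nδ²/(log₂ λ_min)²) - 2 exp(-2nδ²/(log₂ μ_min)²) - 4 M 2^{-n(χ - 2δ)}`. -/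
theorem hsw_error_bound {d L : ℕ}
    (p : Fin L → ℝ) (hp0 : ∀ x, 0 ≤ p x) (hp1 : ∑ x, p x = 1)
    (σ : Fin L → Matrix (Fin d) (Fin d) ℂ)
    (hσpsd : ∀ x, (σ x).PosSemidef) (hσtr : ∀ x, Matrix.trace (σ x) = 1)
    (hbar : (∑ x, p x • σ x).PosSemidef)
    (lamMin : ℝ)
    (hlam : IsLeast {μ : ℝ | μ ≠ 0 ∧ ∃ i, hbar.isHermitian.eigenvalues i = μ} lamMin)
    (muMin : ℝ)
    (hmu : IsLeast {μ : ℝ | μ ≠ 0 ∧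
      ∃ x, 0 < p x ∧ ∃ i, (hσpsd x).isHermitian.eigenvalues i = μ} muMin)
    (n : ℕ) (M : ℕ) (hM1 : 1 ≤ M) (hML : M ≤ L ^ n) (δ : ℝ) (hδ : 0 < δ) :
    ∃ (codes : Fin M → (Fin n → Fin L))
      (Λ : Fin M → Matrix (Fin n → Fin d) (Fin n → Fin d) ℂ),
      (∀ s, (Λ s).PosSemidef) ∧ (1 - ∑ s, Λ s).PosSemidef ∧
      1 - 4 * Real.exp (-(2 * n * δ ^ 2) / (Real.logb 2 lamMin) ^ 2)
        - 2 * Real.exp (-(2 * n * δ ^ 2) / (Real.logb 2 muMin) ^ 2)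
        - 4 * M * (2 : ℝ) ^ (-(n : ℝ) *
            ((vonNeumannEntropy hbar.isHermitian -
              ∑ x, p x * vonNeumannEntropy (hσpsd x).isHermitian) - 2 * δ)) ≤
      (1 / (M : ℝ)) * ∑ s, (Matrix.trace (Λ s * tensorPowState σ (codes s))).re := by
  classical
  obtain ⟨_, x₀, _⟩ := hmu.1
  by_cases hl : Real.logb 2 lamMin = 0
  · refine ⟨fun _ _ => x₀, fun _ => 0, fun _ => Matrix.PosSemidef.zero, ?_, ?_⟩
    · simpa using Matrix.PosSemidef.one
    · rw [hl]
      have h1 : 0 ≤ 4 * (M:ℝ) * (2 : ℝ) ^ (-(n : ℝ) *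
            ((vonNeumannEntropy hbar.isHermitian -
              ∑ x, p x * vonNeumannEntropy (hσpsd x).isHermitian) - 2 * δ)) := by positivity
      have h2 := Real.exp_nonneg (-(2 * n * δ ^ 2) / (Real.logb 2 muMin) ^ 2)
      simp only [zero_mul, Matrix.trace_zero, Complex.zero_re, Finset.sum_const_zero, mul_zero,
        ne_eq, OfNat.ofNat_ne_zero, not_false_eq_true, zero_pow, div_zero, Real.exp_zero]
      linarith
  by_cases hm : Real.logb 2 muMin = 0
  · refine ⟨fun _ _ => x₀, fun _ => 0, fun _ => Matrix.PosSemidef.zero, ?_, ?_⟩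
    · simpa using Matrix.PosSemidef.one
    · rw [hm]
      have h1 : 0 ≤ 4 * (M:ℝ) * (2 : ℝ) ^ (-(n : ℝ) *
            ((vonNeumannEntropy hbar.isHermitian -
              ∑ x, p x * vonNeumannEntropy (hσpsd x).isHermitian) - 2 * δ)) := by positivity
      have h2 := Real.exp_nonneg (-(2 * n * δ ^ 2) / (Real.logb 2 lamMin) ^ 2)
      simp only [zero_mul, Matrix.trace_zero, Complex.zero_re, Finset.sum_const_zero, mul_zero,
        ne_eq, OfNat.ofNat_ne_zero, not_false_eq_true, zero_pow, div_zero, Real.exp_zero]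
      linarith
  exact hsw_main p hp0 hp1 σ hσpsd hσtr hbar lamMin hl hlam muMin hm hmu n M hM1 δ hδ
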